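/- arXiv:math/0605114 — 5 statements merged into one kernel-verified Lean document; each statement's English description precedes it below -/
import Mathlib

section
/- Let X be a nonempty compact Hausdorff space, A a unital C*-algebra, and Φ : C(X, ℂ) → A a unital star-algebra homomorphism whose range is contained in the center of A. For each a ∈ A, the norm function n_a : X → ℝ, n_a(x) = ‖π_x a‖, is upper semicontinuous on X. -/
/-- The smallest closed two-sided ideal `I_x` of `A` containing
`{Φ f : f ∈ C(X, ℂ), f x = 0}`. -/
noncomputable def fiberIdeal {X : Type*} [TopologicalSpace X]
    {A : Type*} [NormedRing A] [StarRing A] [CStarRing A] [NormedAlgebra ℂ A]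
    (Φ : C(X, ℂ) →⋆ₐ[ℂ] A) (x : X) : TwoSidedIdeal A :=
  sInf {J : TwoSidedIdeal A | IsClosed (J : Set A) ∧ ∀ f : C(X, ℂ), f x = 0 → Φ f ∈ J}

/-- The ideal `I_x`, viewed as an additive subgroup of `A` (so that the quotient
`A ⧸ I_x` carries the quotient seminorm `‖π_x a‖ = inf {‖a - j‖ : j ∈ I_x}`). -/
noncomputable def fiberSubgroup {X : Type*} [TopologicalSpace X]
    {A : Type*} [NormedRing A] [StarRing A] [CStarRing A] [NormedAlgebra ℂ A]
    (Φ : C(X, ℂ) →⋆ₐ[ℂ] A) (x : X) : AddSubgroup A :=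
  (TwoSidedIdeal.asIdeal (fiberIdeal Φ x)).toAddSubgroup

open Topology Filter in
/-- Elements of `A` that become small in the fibers near `x`. -/
def SmallNear {X : Type*} [TopologicalSpace X]
    {A : Type*} [NormedRing A] [StarRing A] [CStarRing A] [NormedAlgebra ℂ A]
    (Φ : C(X, ℂ) →⋆ₐ[ℂ] A) (x : X) (j : A) : Prop :=
  ∀ ε > 0, ∀ᶠ y in 𝓝 x, ∃ k ∈ fiberIdeal Φ y, ‖j - k‖ < ε

theorem map_mem_fiberIdeal {X : Type*} [TopologicalSpace X]
    {A : Type*} [NormedRing A] [StarRing A] [CStarRing A] [NormedAlgebra ℂ A]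
    (Φ : C(X, ℂ) →⋆ₐ[ℂ] A) (x : X) (f : C(X, ℂ)) (hf : f x = 0) : Φ f ∈ fiberIdeal Φ x := by
  rw [fiberIdeal, TwoSidedIdeal.mem_sInf]
  exact fun J hJ => hJ.2 f hf

/-- The two-sided ideal of elements that are small near `x`. -/
def smallIdeal {X : Type*} [TopologicalSpace X]
    {A : Type*} [NormedRing A] [StarRing A] [CStarRing A] [NormedAlgebra ℂ A]
    (Φ : C(X, ℂ) →⋆ₐ[ℂ] A) (x : X) : TwoSidedIdeal A :=
  TwoSidedIdeal.mk' {j | SmallNear Φ x j}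
    (fun ε hε => Filter.Eventually.of_forall fun y =>
      ⟨0, (fiberIdeal Φ y).zero_mem, by simpa using hε⟩)
    (by
      intro a b ha hb ε hε
      filter_upwards [ha (ε / 2) (by positivity), hb (ε / 2) (by positivity)] with y h1 h2
      obtain ⟨k, hk, h1⟩ := h1
      obtain ⟨l, hl, h2⟩ := h2
      refine ⟨k + l, (fiberIdeal Φ y).add_mem hk hl, ?_⟩
      have := norm_add_le (a - k) (b - l)
      rw [show a + b - (k + l) = (a - k) + (b - l) by abel]
      linarith)
    (by
      intro a ha ε hε
      filter_upwards [ha ε hε] with y h1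
      obtain ⟨k, hk, h1⟩ := h1
      refine ⟨-k, (fiberIdeal Φ y).neg_mem hk, ?_⟩
      rwa [show -a - -k = -(a - k) by abel, norm_neg])
    (by
      intro a b hb ε hε
      filter_upwards [hb (ε / (‖a‖ + 1)) (by positivity)] with y h1
      obtain ⟨k, hk, h1⟩ := h1
      refine ⟨a * k, (fiberIdeal Φ y).mul_mem_left _ _ hk, ?_⟩
      rw [← mul_sub]
      have := norm_mul_le a (b - k)
      rw [lt_div_iff₀ (by positivity)] at h1
      nlinarith [norm_nonneg (b - k)])
    (by
      intro b a hb ε hε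
      filter_upwards [hb (ε / (‖a‖ + 1)) (by positivity)] with y h1
      obtain ⟨k, hk, h1⟩ := h1
      refine ⟨k * a, (fiberIdeal Φ y).mul_mem_right _ _ hk, ?_⟩
      rw [← sub_mul]
      have := norm_mul_le (b - k) a
      rw [lt_div_iff₀ (by positivity)] at h1
      nlinarith [norm_nonneg (b - k)])

theorem mem_smallIdeal {X : Type*} [TopologicalSpace X]
    {A : Type*} [NormedRing A] [StarRing A] [CStarRing A] [NormedAlgebra ℂ A]
    (Φ : C(X, ℂ) →⋆ₐ[ℂ] A) (x : X) (j : A) : j ∈ smallIdeal Φ x ↔ SmallNear Φ x j := by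
  exact TwoSidedIdeal.mem_mk' {j | SmallNear Φ x j} _ _ _ _ _ j

theorem smallNear_of_mem {X : Type*} [TopologicalSpace X]
    {A : Type*} [NormedRing A] [StarRing A] [CStarRing A] [NormedAlgebra ℂ A]
    (Φ : C(X, ℂ) →⋆ₐ[ℂ] A) (x : X) (j : A) (hj : j ∈ fiberIdeal Φ x) : SmallNear Φ x j := by
  rw [← mem_smallIdeal]
  rw [fiberIdeal, TwoSidedIdeal.mem_sInf] at hj
  refine hj _ ⟨?_, ?_⟩
  · refine isClosed_of_closure_subset fun a ha => ?_
    rw [SetLike.mem_coe, mem_smallIdeal]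
    intro ε hε
    obtain ⟨b, hb, hab⟩ := Metric.mem_closure_iff.1 ha (ε / 2) (by positivity)
    rw [SetLike.mem_coe, mem_smallIdeal] at hb
    filter_upwards [hb (ε / 2) (by positivity)] with y h1
    obtain ⟨k, hk, h1⟩ := h1
    refine ⟨k, hk, ?_⟩
    rw [dist_eq_norm] at hab
    have := norm_add_le (a - b) (b - k)
    rw [sub_add_sub_cancel] at this
    linarith
  · intro f hf
    rw [mem_smallIdeal]
    intro ε hε
    have hc : Filter.Tendsto (fun y => ‖f y‖ * ‖(1 : A)‖) (nhds x) (nhds 0) := by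
      have : Continuous fun y => ‖f y‖ * ‖(1 : A)‖ := by fun_prop
      simpa [hf] using this.tendsto x
    filter_upwards [hc.eventually_lt_const hε] with y hy
    refine ⟨Φ (f - algebraMap ℂ C(X, ℂ) (f y)), map_mem_fiberIdeal Φ y _ (by simp), ?_⟩
    rw [map_sub, sub_sub_cancel, AlgHomClass.commutes, Algebra.algebraMap_eq_smul_one]
    exact (norm_smul_le _ _).trans_lt hy

theorem fiber_norm_lt_iff {X : Type*} [TopologicalSpace X]
    {A : Type*} [NormedRing A] [StarRing A] [CStarRing A] [NormedAlgebra ℂ A]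
    (Φ : C(X, ℂ) →⋆ₐ[ℂ] A) (x : X) (a : A) (c : ℝ) :
    ‖QuotientAddGroup.mk' (fiberSubgroup Φ x) a‖ < c ↔ ∃ k ∈ fiberIdeal Φ x, ‖a - k‖ < c := by
  rw [QuotientAddGroup.norm_lt_iff]
  have hmem : ∀ k, k ∈ fiberSubgroup Φ x ↔ k ∈ fiberIdeal Φ x := fun k => by
    simp [fiberSubgroup]
  constructor
  · rintro ⟨m, hm, h⟩
    refine ⟨-m + a, (hmem _).1 (QuotientAddGroup.eq.1 hm), ?_⟩
    rwa [show a - (-m + a) = m by abel]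
  · rintro ⟨k, hk, h⟩
    refine ⟨a - k, QuotientAddGroup.eq.2 ((hmem _).2 ?_), h⟩
    rwa [show -(a - k) + a = k by abel]

/-- Let `X` be a nonempty compact Hausdorff space, `A` a unital C*-algebra, and
`Φ : C(X, ℂ) → A` a unital star-algebra homomorphism whose range is contained in the
center of `A`.  For each `a ∈ A`, the norm function `n_a : X → ℝ`, `n_a x = ‖π_x a‖`,
is upper semicontinuous on `X`. -/
theorem upperSemicontinuous_fiber_norm {X : Type*} [TopologicalSpace X] [CompactSpace X]
    [T2Space X] [Nonempty X]
    {A : Type*} [NormedRing A] [StarRing A] [CStarRing A] [NormedAlgebra ℂ A]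
    [CompleteSpace A] [StarModule ℂ A]
    (Φ : C(X, ℂ) →⋆ₐ[ℂ] A) (hΦ : ∀ f : C(X, ℂ), Φ f ∈ Set.center A) (a : A) :
    UpperSemicontinuous fun x : X => ‖QuotientAddGroup.mk' (fiberSubgroup Φ x) a‖ := by
  intro x c hc
  obtain ⟨j, hj, hjc⟩ := (fiber_norm_lt_iff Φ x a c).1 hc
  filter_upwards [smallNear_of_mem Φ x j hj (c - ‖a - j‖) (by linarith)] with y hy
  obtain ⟨k, hk, hjk⟩ := hy
  refine (fiber_norm_lt_iff Φ y a c).2 ⟨k, hk, ?_⟩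
  have := norm_add_le (a - j) (j - k)
  rw [sub_add_sub_cancel] at this
  linarith
end

section
/- Let X be a nonempty compact Hausdorff space, A a unital C*-algebra, and Φ : C(X, ℂ) → A a unital star-algebra homomorphism whose range is contained in the center of A. Then for every a ∈ A, the norm of a is recovered from its fibers: ‖a‖ = sSup {‖π_x a‖ : x ∈ X}. In particular, an element a ∈ A is zero if and only if π_x a = 0 for all x ∈ X. -/
theorem fiber_avg {A : Type*} [CStarAlgebra A] {ι : Type*} [Fintype ι] (s b : ι → A)
    (hs : ∀ i, s i ∈ Set.center A) (hsa : ∀ i, star (s i) = s i)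
    (hsum : ∑ i, s i * s i = 1) (M : ℝ) (hM : 0 ≤ M) (hb : ∀ i, ‖b i‖ ≤ M) :
    ‖∑ i, s i * s i * b i‖ ≤ M := by
  letI := CStarAlgebra.spectralOrder A
  haveI := CStarAlgebra.spectralOrderedRing A
  have comm : ∀ i (y : A), s i * y = y * s i := fun i y => ((Set.mem_center_iff.mp (hs i)).comm y)
  set c := ∑ i, s i * s i * b i with hc
  have hcs : star c = ∑ i, star (b i) * (s i * s i) := by
    simp [hc, star_sum, star_mul, hsa]
  have h1 : ∑ i, star (s i * (b i - c)) * (s i * (b i - c)) =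
      ∑ i, s i * (star (b i) * b i) * s i - star c * c := by
    have e : ∀ i, star (s i * (b i - c)) * (s i * (b i - c)) =
        s i * (star (b i) * b i) * s i - star (b i) * (s i * s i) * c
          - star c * (s i * s i * b i) + star c * (s i * s i) * c := by
      intro i
      have e1 : s i * (star (b i) * b i) * s i = star (b i) * (s i * s i) * b i := by
        rw [← mul_assoc, comm i (star (b i)), mul_assoc, mul_assoc, ← comm i (b i)]
        simp only [mul_assoc]
        
      rw [e1, star_mul, hsa, star_sub]
      noncomm_ring
    simp only [e, Finset.sum_add_distrib, Finset.sum_sub_distrib, ← Finset.sum_mul,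
      ← Finset.mul_sum, hsum, ← hcs, ← hc]
    noncomm_ring
  have h2 : star c * c ≤ ∑ i, s i * (star (b i) * b i) * s i := by
    rw [← sub_nonneg, ← h1]
    exact Finset.sum_nonneg fun i _ => star_mul_self_nonneg _
  have h3 : ∑ i, s i * (star (b i) * b i) * s i ≤ algebraMap ℝ A (M ^ 2) := by
    calc _ ≤ ∑ i, s i * algebraMap ℝ A (M ^ 2) * s i := by
          refine Finset.sum_le_sum fun i _ => ?_
          have h4 : star (b i) * b i ≤ algebraMap ℝ A (M ^ 2) := by
            rw [← CStarAlgebra.norm_le_iff_le_algebraMap _ (by positivity)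
              (star_mul_self_nonneg _), CStarRing.norm_star_mul_self]
            nlinarith [hb i, norm_nonneg (b i)]
          have := star_left_conjugate_le_conjugate h4 (s i)
          rwa [hsa] at this
      _ = _ := by
          simp_rw [← Algebra.commutes, mul_assoc, ← Finset.mul_sum, hsum, mul_one]
  have h5 := (CStarAlgebra.norm_le_iff_le_algebraMap _ (by positivity)
    (star_mul_self_nonneg c)).2 (h2.trans h3)
  rw [CStarRing.norm_star_mul_self] at h5
  exact abs_le_of_sq_le_sq' (by nlinarith) hM |>.2

/-- Elements that are small near `x`. -/
def locSmall {X : Type*} [TopologicalSpace X] [CompactSpace X] {A : Type*} [CStarAlgebra A]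
    (Φ : C(X, ℂ) →⋆ₐ[ℂ] A) (x : X) : Set A :=
  {j | ∀ ε > 0, ∃ f : C(X, ℂ), (∀ᶠ y in nhds x, f y = 1) ∧ ‖f‖ ≤ 1 ∧ ‖Φ f * j‖ < ε}

theorem fiber_small {X : Type*} [TopologicalSpace X] [CompactSpace X] {A : Type*}
    [CStarAlgebra A] (Φ : C(X, ℂ) →⋆ₐ[ℂ] A) (hΦ : ∀ f : C(X, ℂ), Φ f ∈ Set.center A) (x : X)
    (j : A) (hj : j ∈ fiberIdeal Φ x) : j ∈ locSmall Φ x := by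
  have comm : ∀ f (y : A), Φ f * y = y * Φ f := fun f y => ((Set.mem_center_iff.mp (hΦ f)).comm y)
  have hn : ∀ f, ‖Φ f‖ ≤ ‖f‖ := fun f => NonUnitalStarAlgHom.norm_apply_le Φ f
  have hle : ∀ (f : C(X, ℂ)) (y : A), ‖f‖ ≤ 1 → ‖Φ f * y‖ ≤ ‖y‖ := fun f y hf =>
    (norm_mul_le _ _).trans (mul_le_of_le_one_left (norm_nonneg _) ((hn f).trans hf))
  have one_le : ‖(1 : C(X, ℂ))‖ ≤ 1 := by
    rw [ContinuousMap.norm_le _ zero_le_one]; simp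
  have right : ∀ {u v : A}, u ∈ locSmall Φ x → u * v ∈ locSmall Φ x := by
    intro u v hu ε hε
    obtain ⟨f, h1, h2, h3⟩ := hu (ε / (‖v‖ + 1)) (by positivity)
    refine ⟨f, h1, h2, ?_⟩
    rw [← mul_assoc]
    rw [lt_div_iff₀ (by positivity)] at h3
    refine (norm_mul_le _ _).trans_lt (lt_of_le_of_lt ?_ h3)
    gcongr
    linarith
  have left : ∀ {v u : A}, u ∈ locSmall Φ x → v * u ∈ locSmall Φ x := by
    intro v u hu ε hε
    obtain ⟨f, h1, h2, h3⟩ := hu (ε / (‖v‖ + 1)) (by positivity)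
    refine ⟨f, h1, h2, ?_⟩
    rw [← mul_assoc, comm, mul_assoc]
    rw [lt_div_iff₀ (by positivity), mul_comm] at h3
    refine (norm_mul_le _ _).trans_lt (lt_of_le_of_lt ?_ h3)
    gcongr
    linarith
  have zero : (0 : A) ∈ locSmall Φ x := fun ε hε =>
    ⟨1, by simp, one_le, by simpa using hε⟩
  have neg : ∀ {u : A}, u ∈ locSmall Φ x → -u ∈ locSmall Φ x := by
    intro u hu ε hε
    simpa using hu ε hε
  have add : ∀ {u v : A}, u ∈ locSmall Φ x → v ∈ locSmall Φ x → u + v ∈ locSmall Φ x := by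
    intro u v hu hv ε hε
    obtain ⟨f, f1, f2, f3⟩ := hu (ε / 2) (by positivity)
    obtain ⟨g, g1, g2, g3⟩ := hv (ε / 2) (by positivity)
    refine ⟨f * g, ?_, ?_, ?_⟩
    · filter_upwards [f1, g1] with y h h'
      simp [h, h']
    · exact (norm_mul_le _ _).trans (mul_le_one₀ f2 (norm_nonneg _) g2)
    · rw [mul_add]
      have e1 : ‖Φ (f * g) * u‖ ≤ ‖Φ f * u‖ := by
        rw [mul_comm f g, map_mul, mul_assoc]; exact hle _ _ g2
      have e2 : ‖Φ (f * g) * v‖ ≤ ‖Φ g * v‖ := by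
        rw [map_mul, mul_assoc]; exact hle _ _ f2
      linarith [norm_add_le (Φ (f * g) * u) (Φ (f * g) * v)]
  have closed : IsClosed (locSmall Φ x) := by
    refine isClosed_of_closure_subset fun u hu ε hε => ?_
    obtain ⟨v, hv, huv⟩ := Metric.mem_closure_iff.mp hu (ε / 2) (by positivity)
    obtain ⟨f, f1, f2, f3⟩ := hv (ε / 2) (by positivity)
    refine ⟨f, f1, f2, ?_⟩
    rw [dist_eq_norm] at huv
    have e : Φ f * u = Φ f * (u - v) + Φ f * v := by noncomm_ring
    rw [e]
    linarith [norm_add_le (Φ f * (u - v)) (Φ f * v), hle f (u - v) f2]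
  have gen : ∀ f : C(X, ℂ), f x = 0 → Φ f ∈ locSmall Φ x := by
    intro f hf ε hε
    set δ := ε / 4 with hδ
    have hδ0 : 0 < δ := by positivity
    let k : C(X, ℂ) := ⟨fun y => ((max 0 (min 1 (2 - ‖f y‖ / δ)) : ℝ) : ℂ), by fun_prop⟩
    have hk : ∀ y, ‖k y‖ = max 0 (min 1 (2 - ‖f y‖ / δ)) := fun y => by
      simp only [k, ContinuousMap.coe_mk, Complex.norm_real, Real.norm_eq_abs]
      exact abs_of_nonneg (le_max_left _ _)
    refine ⟨k, ?_, ?_, ?_⟩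
    · have : ∀ᶠ y in nhds x, ‖f y‖ < δ := by
        apply (f.continuous.norm).continuousAt.eventually_lt continuousAt_const
        simpa [hf] using hδ0
      filter_upwards [this] with y hy
      have : ‖f y‖ / δ < 1 := by rwa [div_lt_one hδ0]
      simp only [k, ContinuousMap.coe_mk]
      rw [min_eq_left (by linarith), max_eq_right zero_le_one]
      simp
    · rw [ContinuousMap.norm_le _ zero_le_one]
      intro y
      rw [hk]
      exact max_le zero_le_one (min_le_left _ _)
    · rw [← map_mul]
      refine (hn _).trans_lt (lt_of_le_of_lt (b := 2 * δ) ?_ (by rw [hδ]; linarith))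
      rw [ContinuousMap.norm_le _ (by positivity)]
      intro y
      rw [ContinuousMap.mul_apply, norm_mul, hk]
      by_cases hy : ‖f y‖ ≤ 2 * δ
      · refine (mul_le_of_le_one_left (norm_nonneg _) ?_).trans hy
        exact max_le zero_le_one (min_le_left _ _)
      · have : 2 < ‖f y‖ / δ := by rw [lt_div_iff₀ hδ0]; linarith
        rw [max_eq_left ((min_le_right _ _).trans (by linarith)), zero_mul]
        positivity
  let J : TwoSidedIdeal A := TwoSidedIdeal.mk' (locSmall Φ x) zero add neg left right
  have hJ : (J : Set A) = locSmall Φ x := by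
    ext u; exact TwoSidedIdeal.mem_mk' _ _ _ _ _ _ _
  have := (TwoSidedIdeal.mem_sInf (R := A)).mp hj J ⟨by rw [hJ]; exact closed, fun f hf => by
    rw [← SetLike.mem_coe, hJ]; exact gen f hf⟩
  rwa [← SetLike.mem_coe, hJ] at this

theorem fiber_bound {X : Type*} [TopologicalSpace X] [CompactSpace X] [T2Space X] {A : Type*}
    [CStarAlgebra A] (Φ : C(X, ℂ) →⋆ₐ[ℂ] A) (hΦ : ∀ f : C(X, ℂ), Φ f ∈ Set.center A)
    (a : A) (M : ℝ) (hM : 0 ≤ M)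
    (h : ∀ x, ∃ j ∈ fiberIdeal Φ x, ‖a - j‖ < M) : ‖a‖ ≤ M := by
  have hn : ∀ f, ‖Φ f‖ ≤ ‖f‖ := fun f => NonUnitalStarAlgHom.norm_apply_le Φ f
  have key : ∀ x, ∃ f : C(X, ℂ), ∃ U : Set X, IsOpen U ∧ x ∈ U ∧ (∀ y ∈ U, f y = 1) ∧
      ‖Φ f * a‖ ≤ M := by
    intro x
    obtain ⟨j, hj, hjM⟩ := h x
    obtain ⟨f, f1, f2, f3⟩ := fiber_small Φ hΦ x j hj (M - ‖a - j‖) (by linarith)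
    obtain ⟨U, hU, hUo, hxU⟩ := eventually_nhds_iff.mp f1
    refine ⟨f, U, hUo, hxU, hU, ?_⟩
    have e : Φ f * a = Φ f * (a - j) + Φ f * j := by noncomm_ring
    have e2 : ‖Φ f * (a - j)‖ ≤ ‖a - j‖ :=
      (norm_mul_le _ _).trans (mul_le_of_le_one_left (norm_nonneg _) ((hn f).trans f2))
    rw [e]
    linarith [norm_add_le (Φ f * (a - j)) (Φ f * j)]
  choose f U hUo hxU hfU hfa using key
  obtain ⟨t, ht⟩ := isCompact_univ.elim_finite_subcover U hUo
    (fun x _ => Set.mem_iUnion.mpr ⟨x, hxU x⟩)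
  obtain ⟨g, hg⟩ := PartitionOfUnity.exists_isSubordinate isClosed_univ
    (fun i : t => U i) (fun i => hUo i) (by
      intro y hy
      obtain ⟨i, hi, hy⟩ := Set.mem_iUnion₂.mp (ht hy)
      exact Set.mem_iUnion.mpr ⟨⟨i, hi⟩, hy⟩)
  let s : t → C(X, ℂ) := fun i =>
    ⟨fun y => ((Real.sqrt (g i y) : ℝ) : ℂ), by fun_prop⟩
  have hss : ∀ i y, s i y * s i y = (g i y : ℂ) := fun i y => by
    simp only [s, ContinuousMap.coe_mk]
    rw [← Complex.ofReal_mul, Real.mul_self_sqrt (g.nonneg i y)]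
  have hsum : ∑ i, s i * s i = 1 := by
    ext y
    have := g.sum_eq_one (Set.mem_univ y)
    rw [finsum_eq_sum_of_fintype] at this
    simp only [ContinuousMap.sum_apply, ContinuousMap.mul_apply, hss, ContinuousMap.one_apply]
    exact_mod_cast this
  have hsf : ∀ i : t, s i * s i * f i = s i * s i := by
    intro i
    ext y
    simp only [ContinuousMap.mul_apply, hss]
    by_cases hy : y ∈ U i
    · rw [hfU _ _ hy, mul_one]
    · have : g i y = 0 := image_eq_zero_of_notMem_tsupport fun h' => hy (hg i h')
      simp [this]
  have hsum' : ∑ i, Φ (s i) * Φ (s i) = 1 := by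
    simp_rw [← map_mul]
    rw [← map_sum, hsum, map_one]
  have := fiber_avg (fun i => Φ (s i)) (fun i : t => Φ (f i) * a) (fun i => hΦ _)
    (fun i => by
      rw [← map_star]
      congr 1
      ext y
      simp [s]) hsum' M hM (fun i => hfa i)
  have e : ∑ i, Φ (s i) * Φ (s i) * (Φ (f i) * a) = a := by
    have : ∀ i : t, Φ (s i) * Φ (s i) * (Φ (f i) * a) = Φ (s i) * Φ (s i) * a := fun i => by
      rw [← mul_assoc, ← map_mul, ← map_mul, hsf]
    simp_rw [this, ← Finset.sum_mul, hsum', one_mul]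
  rwa [e] at this

/-- Let `X` be a nonempty compact Hausdorff space, `A` a unital C*-algebra, and
`Φ : C(X, ℂ) → A` a unital star-algebra homomorphism whose range is contained in the
center of `A`.  Then for every `a ∈ A` the norm of `a` is recovered from its fibers:
`‖a‖ = sSup {‖π_x a‖ : x ∈ X}`.  In particular, `a = 0` if and only if `π_x a = 0`
for all `x ∈ X`. -/
theorem norm_eq_sSup_fiber_norms {X : Type*} [TopologicalSpace X] [CompactSpace X]
    [T2Space X] [Nonempty X]
    {A : Type*} [NormedRing A] [StarRing A] [CStarRing A] [NormedAlgebra ℂ A]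
    [CompleteSpace A] [StarModule ℂ A]
    (Φ : C(X, ℂ) →⋆ₐ[ℂ] A) (hΦ : ∀ f : C(X, ℂ), Φ f ∈ Set.center A) (a : A) :
    ‖a‖ = sSup (Set.range fun x : X => ‖QuotientAddGroup.mk' (fiberSubgroup Φ x) a‖) ∧
    (a = 0 ↔ ∀ x : X, QuotientAddGroup.mk' (fiberSubgroup Φ x) a = 0) := by
  letI : CStarAlgebra A := {}
  have hle : ∀ x : X, ‖QuotientAddGroup.mk' (fiberSubgroup Φ x) a‖ ≤ ‖a‖ := fun x =>
    QuotientAddGroup.norm_mk_le_norm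
  have hbdd : BddAbove (Set.range fun x : X => ‖QuotientAddGroup.mk' (fiberSubgroup Φ x) a‖) :=
    ⟨‖a‖, by rintro _ ⟨x, rfl⟩; exact hle x⟩
  have main : ‖a‖ = sSup (Set.range fun x : X =>
      ‖QuotientAddGroup.mk' (fiberSubgroup Φ x) a‖) := by
    apply le_antisymm
    · refine le_of_forall_pos_le_add fun ε hε => ?_
      have hs : ∀ x : X, ‖QuotientAddGroup.mk' (fiberSubgroup Φ x) a‖ ≤ sSup (Set.range
          fun x : X => ‖QuotientAddGroup.mk' (fiberSubgroup Φ x) a‖) := fun x =>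
        le_csSup hbdd ⟨x, rfl⟩
      refine fiber_bound Φ hΦ a _ ?_ fun x => ?_
      · have x := Classical.arbitrary X
        linarith [hs x, norm_nonneg (QuotientAddGroup.mk' (fiberSubgroup Φ x) a)]
      · obtain ⟨m, hm, hlt⟩ := QuotientAddGroup.exists_norm_mk_lt
          (QuotientAddGroup.mk' (fiberSubgroup Φ x) a) hε
        refine ⟨a - m, ?_, ?_⟩
        · have h1 : -m + a ∈ fiberSubgroup Φ x := QuotientAddGroup.eq.mp hm
          have h2 : -m + a ∈ fiberIdeal Φ x := TwoSidedIdeal.mem_asIdeal.mp h1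
          rwa [sub_eq_neg_add]
        · rw [sub_sub_cancel]
          linarith [hs x]
    · refine csSup_le (Set.range_nonempty _) ?_
      rintro _ ⟨x, rfl⟩
      exact hle x
  refine ⟨main, ?_, fun h => ?_⟩
  · rintro rfl x
    exact map_zero _
  · rw [← norm_eq_zero, main]
    have : (fun x : X => ‖QuotientAddGroup.mk' (fiberSubgroup Φ x) a‖) = fun _ => 0 := by
      funext x
      rw [h x, norm_zero]
    rw [this, Set.range_const, csSup_singleton]
end

section
/- Let X be a nonempty compact Hausdorff space, A a unital C*-algebra, and Φ : C(X, ℂ) → A an injective unital star-algebra homomorphism whose range is contained in the center of A. Then every fiber of A is nonzero: for each x ∈ X, the ideal I_x is proper (1 ∉ I_x), equivalently π_x 1 ≠ 0 in A ⧸ I_x. -/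
lemma fiber_norm_map {X : Type*} [TopologicalSpace X] [CompactSpace X]
    {A : Type*} [NormedRing A] [StarRing A] [CStarRing A] [NormedAlgebra ℂ A]
    [CompleteSpace A] [StarModule ℂ A]
    (Φ : C(X, ℂ) →⋆ₐ[ℂ] A) (hinj : Function.Injective Φ) (f : C(X, ℂ)) : ‖Φ f‖ = ‖f‖ := by
  letI : CStarAlgebra A := {}
  exact NonUnitalStarAlgHom.norm_map Φ hinj f

/-- Elements whose pointwise norm at `x` vanishes. -/
def fiberAux {X : Type*} [TopologicalSpace X] [CompactSpace X]
    {A : Type*} [NormedRing A] [StarRing A] [CStarRing A] [NormedAlgebra ℂ A]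
    (Φ : C(X, ℂ) →⋆ₐ[ℂ] A) (hΦ : ∀ f : C(X, ℂ), Φ f ∈ Set.center A)
    (hn : ∀ f, ‖Φ f‖ = ‖f‖) (x : X) : TwoSidedIdeal A :=
  TwoSidedIdeal.mk' {a : A | ∀ ε > 0, ∃ g : C(X, ℂ), g x = 1 ∧ ‖g‖ ≤ 1 ∧ ‖Φ g * a‖ ≤ ε}
    (by
      intro ε hε
      refine ⟨1, by simp, ?_, by simpa using hε.le⟩
      exact (ContinuousMap.norm_le _ zero_le_one).2 (by simp))
    (by
      intro a b ha hb ε hε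
      obtain ⟨g, hg, hg1, hga⟩ := ha (ε / 2) (by positivity)
      obtain ⟨h, hh, hh1, hhb⟩ := hb (ε / 2) (by positivity)
      refine ⟨g * h, by simp [hg, hh], (norm_mul_le _ _).trans (mul_le_one₀ hg1 (norm_nonneg _) hh1), ?_⟩
      have e : Φ (g * h) * (a + b) = Φ h * (Φ g * a) + Φ g * (Φ h * b) := by
        rw [mul_add]
        congr 1
        · rw [mul_comm g h, map_mul, mul_assoc]
        · rw [map_mul, mul_assoc]
      rw [e]
      have h1 : ‖Φ h * (Φ g * a)‖ ≤ ‖Φ g * a‖ :=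
        (norm_mul_le _ _).trans (mul_le_of_le_one_left (norm_nonneg _) ((hn h).trans_le hh1))
      have h2 : ‖Φ g * (Φ h * b)‖ ≤ ‖Φ h * b‖ :=
        (norm_mul_le _ _).trans (mul_le_of_le_one_left (norm_nonneg _) ((hn g).trans_le hg1))
      linarith [norm_add_le (Φ h * (Φ g * a)) (Φ g * (Φ h * b))])
    (by
      intro a ha ε hε
      simpa using ha ε hε)
    (by
      intro b a ha ε hε
      obtain ⟨g, hg, hg1, hga⟩ := ha (ε / (‖b‖ + 1)) (by positivity)
      refine ⟨g, hg, hg1, ?_⟩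
      have e : Φ g * (b * a) = b * (Φ g * a) := by
        rw [← mul_assoc, (Set.mem_center_iff.1 (hΦ g)).comm b, mul_assoc]
      rw [e]
      rw [le_div_iff₀ (by positivity)] at hga
      nlinarith [norm_mul_le b (Φ g * a), norm_nonneg (Φ g * a)])
    (by
      intro a b ha ε hε
      obtain ⟨g, hg, hg1, hga⟩ := ha (ε / (‖b‖ + 1)) (by positivity)
      refine ⟨g, hg, hg1, ?_⟩
      rw [← mul_assoc]
      rw [le_div_iff₀ (by positivity)] at hga
      nlinarith [norm_mul_le (Φ g * a) b, norm_nonneg (Φ g * a)])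

lemma mem_fiberAux {X : Type*} [TopologicalSpace X] [CompactSpace X]
    {A : Type*} [NormedRing A] [StarRing A] [CStarRing A] [NormedAlgebra ℂ A]
    (Φ : C(X, ℂ) →⋆ₐ[ℂ] A) (hΦ : ∀ f : C(X, ℂ), Φ f ∈ Set.center A)
    (hn : ∀ f, ‖Φ f‖ = ‖f‖) (x : X) (a : A) :
    a ∈ fiberAux Φ hΦ hn x ↔
      ∀ ε > 0, ∃ g : C(X, ℂ), g x = 1 ∧ ‖g‖ ≤ 1 ∧ ‖Φ g * a‖ ≤ ε := by
  unfold fiberAux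
  rw [TwoSidedIdeal.mem_mk']
  rfl

lemma one_notMem_fiberIdeal {X : Type*} [TopologicalSpace X] [CompactSpace X]
    {A : Type*} [NormedRing A] [StarRing A] [CStarRing A] [NormedAlgebra ℂ A]
    (Φ : C(X, ℂ) →⋆ₐ[ℂ] A) (hΦ : ∀ f : C(X, ℂ), Φ f ∈ Set.center A)
    (hn : ∀ f, ‖Φ f‖ = ‖f‖) (x : X) : (1 : A) ∉ fiberIdeal Φ x := by
  intro h
  have h' := ((TwoSidedIdeal.mem_sInf A).1 h) (fiberAux Φ hΦ hn x) ⟨?_, ?_⟩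
  · rw [mem_fiberAux] at h'
    obtain ⟨g, hg, -, hg2⟩ := h' (1 / 2) (by norm_num)
    rw [mul_one, hn] at hg2
    have := g.norm_coe_le_norm x
    rw [hg, norm_one] at this
    linarith
  · rw [← isSeqClosed_iff_isClosed]
    intro u a hu hlim
    rw [SetLike.mem_coe, mem_fiberAux]
    intro ε hε
    obtain ⟨n, hn'⟩ := ((Metric.tendsto_nhds.1 hlim) (ε / 2) (by positivity)).exists
    obtain ⟨g, hg, hg1, hg2⟩ := (mem_fiberAux Φ hΦ hn x _).1 (hu n) (ε / 2) (by positivity)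
    refine ⟨g, hg, hg1, ?_⟩
    rw [dist_eq_norm, norm_sub_rev] at hn'
    have e : Φ g * a = Φ g * (a - u n) + Φ g * u n := by rw [← mul_add]; simp
    have h1 : ‖Φ g * (a - u n)‖ ≤ ‖a - u n‖ :=
      (norm_mul_le _ _).trans (mul_le_of_le_one_left (norm_nonneg _) ((hn g).trans_le hg1))
    rw [e]
    linarith [norm_add_le (Φ g * (a - u n)) (Φ g * u n)]
  · intro f hf
    rw [mem_fiberAux]
    intro ε hε
    have hpos : ∀ y, 0 < ε + ‖f y‖ := fun y => by positivity
    refine ⟨⟨fun y => ((ε / (ε + ‖f y‖) : ℝ) : ℂ), ?_⟩, ?_, ?_, ?_⟩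
    · exact Complex.continuous_ofReal.comp
        (continuous_const.div (by fun_prop) (fun y => (hpos y).ne'))
    · simp [hf, hε.ne']
    · refine (ContinuousMap.norm_le _ zero_le_one).2 fun y => ?_
      rw [ContinuousMap.coe_mk, Complex.norm_real, Real.norm_of_nonneg (by positivity),
        div_le_one (hpos y)]
      linarith [norm_nonneg (f y)]
    · rw [← map_mul, hn]
      refine (ContinuousMap.norm_le _ hε.le).2 fun y => ?_
      rw [ContinuousMap.mul_apply, norm_mul, ContinuousMap.coe_mk, Complex.norm_real,
        Real.norm_of_nonneg (by positivity), div_mul_eq_mul_div, div_le_iff₀ (hpos y)]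
      nlinarith [norm_nonneg (f y)]

/-- Let `X` be a nonempty compact Hausdorff space, `A` a unital C*-algebra, and
`Φ : C(X, ℂ) → A` an injective unital star-algebra homomorphism whose range is contained
in the center of `A`.  Then every fiber of `A` is nonzero: for each `x ∈ X`, the ideal
`I_x` is proper (`1 ∉ I_x`), equivalently `π_x 1 ≠ 0` in `A ⧸ I_x`. -/
theorem fiber_nontrivial {X : Type*} [TopologicalSpace X] [CompactSpace X]
    [T2Space X] [Nonempty X]
    {A : Type*} [NormedRing A] [StarRing A] [CStarRing A] [NormedAlgebra ℂ A]
    [CompleteSpace A] [StarModule ℂ A]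
    (Φ : C(X, ℂ) →⋆ₐ[ℂ] A) (hΦ : ∀ f : C(X, ℂ), Φ f ∈ Set.center A)
    (hinj : Function.Injective Φ) (x : X) :
    (1 : A) ∉ fiberIdeal Φ x ∧
    QuotientAddGroup.mk' (fiberSubgroup Φ x) (1 : A) ≠ 0 := by
  have h := one_notMem_fiberIdeal Φ hΦ (fiber_norm_map Φ hinj) x
  refine ⟨h, fun h0 => h ?_⟩
  have h1 := (QuotientAddGroup.eq_zero_iff (N := fiberSubgroup Φ x) (1 : A)).1 h0
  exact TwoSidedIdeal.mem_asIdeal.1 h1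
end

section
/- Let X be a nonempty compact Hausdorff space, A a unital C*-algebra, and Φ : C(X, ℂ) → A a unital star-algebra homomorphism whose range is contained in the center of A. Then for each x ∈ X, the set of products {Φ f * a : f ∈ C(X, ℂ) with f x = 0, a ∈ A} is already a closed two-sided ideal of A; in particular it coincides with the smallest closed two-sided ideal I_x of A containing {Φ f : f ∈ C(X, ℂ), f x = 0}. -/
/-- The elements of `A` that are approximately annihilated by `Φ u` for contractions `u`
with `u x = 1`. -/
def ApproxVanish {X : Type*} [TopologicalSpace X] [CompactSpace X]
    {A : Type*} [NormedRing A] [StarRing A] [NormedAlgebra ℂ A]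
    (Φ : C(X, ℂ) →⋆ₐ[ℂ] A) (x : X) (y : A) : Prop :=
  ∀ ε : ℝ, 0 < ε → ∃ u : C(X, ℂ), u x = 1 ∧ ‖u‖ ≤ 1 ∧ ‖Φ u * y‖ ≤ ε

theorem phi_norm_le {X : Type*} [TopologicalSpace X] [CompactSpace X]
    {A : Type*} [NormedRing A] [StarRing A] [CStarRing A] [NormedAlgebra ℂ A]
    [CompleteSpace A] [StarModule ℂ A]
    (Φ : C(X, ℂ) →⋆ₐ[ℂ] A) (f : C(X, ℂ)) : ‖Φ f‖ ≤ ‖f‖ := by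
  let _ : CStarAlgebra A := {}
  exact NonUnitalStarAlgHom.norm_apply_le Φ f

theorem phi_mul_norm_le {X : Type*} [TopologicalSpace X] [CompactSpace X]
    {A : Type*} [NormedRing A] [StarRing A] [CStarRing A] [NormedAlgebra ℂ A]
    [CompleteSpace A] [StarModule ℂ A]
    (Φ : C(X, ℂ) →⋆ₐ[ℂ] A) (f : C(X, ℂ)) (a : A) : ‖Φ f * a‖ ≤ ‖f‖ * ‖a‖ :=
  (norm_mul_le _ _).trans (mul_le_mul_of_nonneg_right (phi_norm_le Φ f) (norm_nonneg _))

theorem approxVanish_of_product {X : Type*} [TopologicalSpace X] [CompactSpace X]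
    {A : Type*} [NormedRing A] [StarRing A] [CStarRing A] [NormedAlgebra ℂ A]
    [CompleteSpace A] [StarModule ℂ A]
    (Φ : C(X, ℂ) →⋆ₐ[ℂ] A) (x : X) (f : C(X, ℂ)) (hf : f x = 0) (a : A) :
    ApproxVanish Φ x (Φ f * a) := by
  intro ε hε
  obtain ⟨δ, hδ, hδε⟩ : ∃ δ : ℝ, 0 < δ ∧ δ * ‖a‖ ≤ ε := by
    refine ⟨ε / (‖a‖ + 1), by positivity, ?_⟩
    rw [div_mul_eq_mul_div, div_le_iff₀ (by positivity)]
    nlinarith [norm_nonneg a]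
  have hpos : ∀ t, 0 < δ + ‖f t‖ := fun t => by positivity
  let u : C(X, ℂ) := ⟨fun t => ((δ / (δ + ‖f t‖) : ℝ) : ℂ), by
    refine Complex.continuous_ofReal.comp (continuous_const.div (by fun_prop) ?_)
    exact fun t => (hpos t).ne'⟩
  have hu : ∀ t, ‖u t‖ = δ / (δ + ‖f t‖) := fun t => by
    change ‖((δ / (δ + ‖f t‖) : ℝ) : ℂ)‖ = _
    rw [Complex.norm_real, Real.norm_eq_abs, abs_of_nonneg (div_nonneg hδ.le (hpos t).le)]
  refine ⟨u, ?_, ?_, ?_⟩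
  · change ((δ / (δ + ‖f x‖) : ℝ) : ℂ) = 1
    simp [hf, hδ.ne']
  · refine (ContinuousMap.norm_le _ zero_le_one).2 fun t => ?_
    rw [hu, div_le_one (hpos t)]
    linarith [norm_nonneg (f t)]
  · rw [← mul_assoc, ← map_mul]
    refine (phi_mul_norm_le Φ _ _).trans (le_trans ?_ hδε)
    refine mul_le_mul_of_nonneg_right ?_ (norm_nonneg _)
    refine (ContinuousMap.norm_le _ hδ.le).2 fun t => ?_
    rw [ContinuousMap.mul_apply, norm_mul, hu, div_mul_eq_mul_div, div_le_iff₀ (hpos t)]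
    nlinarith [norm_nonneg (f t)]

theorem product_of_approxVanish {X : Type*} [TopologicalSpace X] [CompactSpace X]
    {A : Type*} [NormedRing A] [StarRing A] [CStarRing A] [NormedAlgebra ℂ A]
    [CompleteSpace A] [StarModule ℂ A]
    (Φ : C(X, ℂ) →⋆ₐ[ℂ] A) (x : X) (y : A) (hy : ApproxVanish Φ x y) :
    ∃ f : C(X, ℂ), ∃ a : A, f x = 0 ∧ y = Φ f * a := by
  have hex : ∀ n : ℕ, ∃ u : C(X, ℂ), u x = 1 ∧ ‖u‖ ≤ 1 ∧ ‖Φ u * y‖ ≤ (1 / 4 : ℝ) ^ n :=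
    fun n => hy _ (by positivity)
  choose u hux hu1 huy using hex
  let c : ℕ → ℂ := fun n => (1 / 2 : ℂ) ^ (n + 1)
  have hc : ∀ n, ‖c n‖ = (1 / 2 : ℝ) ^ (n + 1) := fun n => by simp [c]
  let h : ℕ → C(X, ℂ) := fun n => 1 - ∑ k ∈ Finset.range n, c k • u k
  have hsucc : ∀ n, h (n + 1) = h n - c n • u n := fun n => by
    simp only [h, Finset.sum_range_succ]; abel
  have hcu : ∀ n, ‖c n • u n‖ ≤ (1 / 2 : ℝ) ^ (n + 1) := fun n => by
    rw [norm_smul, hc]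
    exact mul_le_of_le_one_right (by positivity) (hu1 n)
  have hlow : ∀ n t, (1 / 2 : ℝ) ^ n ≤ ‖h n t‖ := by
    intro n t
    induction n with
    | zero => simp [h]
    | succ n ih =>
      have h1 : ‖(c n • u n) t‖ ≤ (1 / 2 : ℝ) ^ (n + 1) :=
        (ContinuousMap.norm_coe_le_norm _ t).trans (hcu n)
      have h2 := norm_sub_norm_le (h n t) ((c n • u n) t)
      rw [hsucc, ContinuousMap.sub_apply]
      have h3 : (1 / 2 : ℝ) ^ n = 2 * (1 / 2 : ℝ) ^ (n + 1) := by ring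
      linarith
  have hx : ∀ n, h n x = (1 / 2 : ℂ) ^ n := by
    intro n
    induction n with
    | zero => simp [h]
    | succ n ih =>
      rw [hsucc, ContinuousMap.sub_apply, ih, ContinuousMap.smul_apply, hux]
      simp only [c, smul_eq_mul]; ring
  have hne : ∀ n t, h n t ≠ 0 := fun n t =>
    norm_pos_iff.1 (lt_of_lt_of_le (by positivity) (hlow n t))
  let g : ℕ → C(X, ℂ) := fun n => ⟨fun t => (h n t)⁻¹, (h n).continuous.inv₀ (hne n)⟩
  have hgh : ∀ n, g n * h n = 1 := fun n => by
    ext t; exact inv_mul_cancel₀ (hne n t)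
  have hgn : ∀ n, ‖g n‖ ≤ (2 : ℝ) ^ n := fun n => by
    refine (ContinuousMap.norm_le _ (by positivity)).2 fun t => ?_
    change ‖(h n t)⁻¹‖ ≤ _
    rw [norm_inv]
    refine (inv_anti₀ (by positivity) (hlow n t)).trans (le_of_eq ?_)
    simp
  have hdiff : ∀ n, g n - g (n + 1) = -((g n * g (n + 1)) * (c n • u n)) := fun n => by
    have e : c n • u n = h n - h (n + 1) := by rw [hsucc]; abel
    rw [e]
    linear_combination (-g n) * hgh (n + 1) + g (n + 1) * hgh n
  have hcauchy : CauchySeq h := by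
    refine cauchySeq_of_le_geometric (1 / 2) 1 (by norm_num) fun n => ?_
    rw [dist_eq_norm, hsucc, sub_sub_cancel]
    refine (hcu n).trans ?_
    rw [pow_succ]
    nlinarith [pow_pos (show (0 : ℝ) < 1 / 2 by norm_num) n]
  have acauchy : CauchySeq fun n => Φ (g n) * y := by
    refine cauchySeq_of_le_geometric (1 / 2) 1 (by norm_num) fun n => ?_
    rw [dist_eq_norm, ← sub_mul, ← map_sub, hdiff, map_neg, neg_mul, norm_neg, map_mul, mul_assoc]
    refine (phi_mul_norm_le Φ _ _).trans ?_
    have e1 : ‖g n * g (n + 1)‖ ≤ 2 ^ n * 2 ^ (n + 1) :=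
      (norm_mul_le _ _).trans
        (mul_le_mul (hgn n) (hgn (n + 1)) (norm_nonneg _) (by positivity))
    have e2 : ‖Φ (c n • u n) * y‖ ≤ (1 / 2 : ℝ) ^ (n + 1) * (1 / 4 : ℝ) ^ n := by
      rw [map_smul, smul_mul_assoc, norm_smul, hc]
      exact mul_le_mul_of_nonneg_left (huy n) (by positivity)
    refine (mul_le_mul e1 e2 (norm_nonneg _) (by positivity)).trans (le_of_eq ?_)
    have e4 : (1 / 4 : ℝ) ^ n = (1 / 2) ^ n * (1 / 2) ^ n := by
      rw [← mul_pow]; norm_num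
    have e5 : (2 : ℝ) ^ n * (1 / 2) ^ n = 1 := by
      rw [← mul_pow]; norm_num
    rw [e4, pow_succ, pow_succ]
    linear_combination ((1 / 2 : ℝ) ^ n * (2 ^ n * (1 / 2) ^ n + 1)) * e5
  obtain ⟨f, hf⟩ := cauchySeq_tendsto_of_complete hcauchy
  obtain ⟨a, ha⟩ := cauchySeq_tendsto_of_complete acauchy
  refine ⟨f, a, ?_, ?_⟩
  · have t1 : Filter.Tendsto (fun n => h n x) Filter.atTop (nhds (f x)) :=
      ((continuous_eval_const x).tendsto f).comp hf
    have t2 : Filter.Tendsto (fun n => h n x) Filter.atTop (nhds 0) := by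
      simp only [hx]
      exact tendsto_pow_atTop_nhds_zero_of_norm_lt_one (by norm_num)
    exact tendsto_nhds_unique t1 t2
  · have hcont : Continuous Φ :=
      AddMonoidHomClass.continuous_of_bound Φ 1 fun f => by simpa using phi_norm_le Φ f
    have t1 : Filter.Tendsto (fun n => Φ (h n) * (Φ (g n) * y)) Filter.atTop
        (nhds (Φ f * a)) := ((hcont.tendsto f).comp hf).mul ha
    have t2 : (fun n => Φ (h n) * (Φ (g n) * y)) = fun _ => y := by
      funext n
      rw [← mul_assoc, ← map_mul, mul_comm, hgh, map_one, one_mul]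
    rw [t2] at t1
    exact tendsto_nhds_unique tendsto_const_nhds t1

/-- Let `X` be a nonempty compact Hausdorff space, `A` a unital C*-algebra, and
`Φ : C(X, ℂ) → A` a unital star-algebra homomorphism whose range is contained in the
center of `A`.  Then for each `x ∈ X`, the set of products
`{Φ f * a : f ∈ C(X, ℂ), f x = 0, a ∈ A}` is already a closed two-sided ideal of `A`;
in particular it coincides with the smallest closed two-sided ideal `I_x` of `A`
containing `{Φ f : f ∈ C(X, ℂ), f x = 0}`. -/
theorem products_eq_fiberIdeal {X : Type*} [TopologicalSpace X] [CompactSpace X]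
    [T2Space X] [Nonempty X]
    {A : Type*} [NormedRing A] [StarRing A] [CStarRing A] [NormedAlgebra ℂ A]
    [CompleteSpace A] [StarModule ℂ A]
    (Φ : C(X, ℂ) →⋆ₐ[ℂ] A) (hΦ : ∀ f : C(X, ℂ), Φ f ∈ Set.center A) (x : X) :
    IsClosed {y : A | ∃ f : C(X, ℂ), ∃ a : A, f x = 0 ∧ y = Φ f * a} ∧
    (∃ J : TwoSidedIdeal A,
        (J : Set A) = {y : A | ∃ f : C(X, ℂ), ∃ a : A, f x = 0 ∧ y = Φ f * a}) ∧
    {y : A | ∃ f : C(X, ℂ), ∃ a : A, f x = 0 ∧ y = Φ f * a} = (fiberIdeal Φ x : Set A) := by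
  have hS : {y : A | ∃ f : C(X, ℂ), ∃ a : A, f x = 0 ∧ y = Φ f * a}
      = {y : A | ApproxVanish Φ x y} := by
    ext y
    constructor
    · rintro ⟨f, a, hf, rfl⟩
      exact approxVanish_of_product Φ x f hf a
    · exact product_of_approxVanish Φ x y
  have hcomm : ∀ (f : C(X, ℂ)) (a : A), Φ f * a = a * Φ f := fun f a =>
    ((Set.mem_center_iff.1 (hΦ f)).comm a).eq
  have hclosed : IsClosed {y : A | ∃ f : C(X, ℂ), ∃ a : A, f x = 0 ∧ y = Φ f * a} := by
    rw [hS]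
    refine isClosed_of_closure_subset fun y hy ε hε => ?_
    obtain ⟨z, hz, hyz⟩ := Metric.mem_closure_iff.1 hy (ε / 2) (by positivity)
    obtain ⟨u, hux, hu1, hu⟩ := hz (ε / 2) (by positivity)
    refine ⟨u, hux, hu1, ?_⟩
    rw [dist_eq_norm] at hyz
    have e1 : ‖Φ u * (y - z)‖ ≤ ‖y - z‖ :=
      (phi_mul_norm_le Φ _ _).trans (mul_le_of_le_one_left (norm_nonneg _) hu1)
    have e2 : Φ u * y = Φ u * (y - z) + Φ u * z := by noncomm_ring
    rw [e2]
    refine (norm_add_le _ _).trans ?_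
    linarith
  have hadd : ∀ {y z : A}, ApproxVanish Φ x y → ApproxVanish Φ x z →
      ApproxVanish Φ x (y + z) := by
    intro y z hy hz ε hε
    obtain ⟨u, hux, hu1, hu⟩ := hy (ε / 2) (by positivity)
    obtain ⟨v, hvx, hv1, hv⟩ := hz (ε / 2) (by positivity)
    refine ⟨u * v, by simp [hux, hvx], (norm_mul_le _ _).trans
      (mul_le_one₀ hu1 (norm_nonneg _) hv1), ?_⟩
    have e : Φ (u * v) * (y + z) = Φ v * (Φ u * y) + Φ u * (Φ v * z) := by
      rw [mul_add, ← mul_assoc, ← mul_assoc, ← map_mul, ← map_mul, mul_comm v u]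
    have e1 : ‖Φ v * (Φ u * y)‖ ≤ ‖Φ u * y‖ :=
      (phi_mul_norm_le Φ _ _).trans (mul_le_of_le_one_left (norm_nonneg _) hv1)
    have e2 : ‖Φ u * (Φ v * z)‖ ≤ ‖Φ v * z‖ :=
      (phi_mul_norm_le Φ _ _).trans (mul_le_of_le_one_left (norm_nonneg _) hu1)
    rw [e]
    refine (norm_add_le _ _).trans ?_
    linarith
  let J : TwoSidedIdeal A := TwoSidedIdeal.mk'
    {y : A | ∃ f : C(X, ℂ), ∃ a : A, f x = 0 ∧ y = Φ f * a}
    ⟨0, 0, rfl, by simp⟩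
    (fun {y z} hy hz => by
      rw [hS] at hy hz ⊢
      exact hadd hy hz)
    (by
      rintro _ ⟨f, a, hf, rfl⟩
      exact ⟨f, -a, hf, by simp⟩)
    (by
      rintro b _ ⟨f, a, hf, rfl⟩
      exact ⟨f, b * a, hf, by rw [← mul_assoc, ← hcomm, mul_assoc]⟩)
    (by
      rintro _ b ⟨f, a, hf, rfl⟩
      exact ⟨f, a * b, hf, by rw [mul_assoc]⟩)
  have hJ : (J : Set A) = {y : A | ∃ f : C(X, ℂ), ∃ a : A, f x = 0 ∧ y = Φ f * a} :=
    TwoSidedIdeal.coe_mk' _ _ _ _ _ _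
  refine ⟨hclosed, ⟨J, hJ⟩, ?_⟩
  apply Set.Subset.antisymm
  · rintro _ ⟨f, a, hf, rfl⟩
    change _ ∈ fiberIdeal Φ x
    unfold fiberIdeal
    rw [TwoSidedIdeal.mem_sInf]
    rintro K ⟨-, hK⟩
    exact K.mul_mem_right _ _ (hK f hf)
  · rw [← hJ]
    have hle : fiberIdeal Φ x ≤ J := by
      refine sInf_le ⟨by rw [hJ]; exact hclosed, fun f hf => ?_⟩
      rw [← SetLike.mem_coe, hJ]
      exact ⟨f, 1, hf, by simp⟩
    exact hle
end

section
/- Let X be a nonempty compact Hausdorff space, A a unital C*-algebra, and Φ : C(X, ℂ) → A a unital star-algebra homomorphism whose range is contained in the center of A. Form the total space Â = Σ (x : X), A ⧸ I_x, and for every open U ⊆ X, a ∈ A, and ε > 0 define the tube T(U, a, ε) = {p : Â | p.1 ∈ U and ‖p.2 - π_{p.1} a‖ < ε}. Then: (i) the tubes cover Â; and (ii) for any two tubes T(U, a, ε), T(V, b, δ) and any point p in their intersection, there exist an open W ⊆ X, c ∈ A, and γ > 0 with p ∈ T(W, c, γ) ⊆ T(U, a, ε) ∩ T(V, b, δ).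 Hence the family of tubes is a basis for a topology on Â. -/
/-- The tube `T(U, a, ε)` in the total space `Â = Σ (x : X), A ⧸ I_x`:
the set of points `p` with `p.1 ∈ U` and `‖p.2 - π_{p.1} a‖ < ε`. -/
noncomputable def tube {X : Type*} [TopologicalSpace X]
    {A : Type*} [NormedRing A] [StarRing A] [CStarRing A] [NormedAlgebra ℂ A]
    (Φ : C(X, ℂ) →⋆ₐ[ℂ] A) (U : Set X) (a : A) (ε : ℝ) :
    Set (Σ x : X, A ⧸ fiberSubgroup Φ x) :=
  {p | p.1 ∈ U ∧ ‖p.2 - QuotientAddGroup.mk' (fiberSubgroup Φ p.1) a‖ < ε}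

theorem mem_fiberSubgroup_iff {X : Type*} [TopologicalSpace X]
    {A : Type*} [NormedRing A] [StarRing A] [CStarRing A] [NormedAlgebra ℂ A]
    (Φ : C(X, ℂ) →⋆ₐ[ℂ] A) (x : X) (a : A) :
    a ∈ fiberSubgroup Φ x ↔ a ∈ fiberIdeal Φ x := by
  simp [fiberSubgroup]

theorem norm_mk_lt_iff {A : Type*} [NormedRing A] (S : AddSubgroup A) (a : A) (r : ℝ) :
    ‖QuotientAddGroup.mk' S a‖ < r ↔ ∃ j ∈ S, ‖a - j‖ < r := by
  rw [QuotientAddGroup.norm_lt_iff]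
  constructor
  · rintro ⟨m, hm, hr⟩
    refine ⟨a - m, ?_, by simpa using hr⟩
    have h : (QuotientAddGroup.mk m : A ⧸ S) = QuotientAddGroup.mk a := hm
    rw [QuotientAddGroup.eq] at h
    rwa [sub_eq_neg_add]
  · rintro ⟨j, hj, hr⟩
    refine ⟨a - j, ?_, hr⟩
    change (QuotientAddGroup.mk (a - j) : A ⧸ S) = QuotientAddGroup.mk a
    rw [QuotientAddGroup.eq]
    simpa using hj

/-- Elements of `A` whose fibre norm tends to zero at `x`. -/
def SmallAt {X : Type*} [TopologicalSpace X]
    {A : Type*} [NormedRing A] [StarRing A] [CStarRing A] [NormedAlgebra ℂ A]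
    (Φ : C(X, ℂ) →⋆ₐ[ℂ] A) (x : X) (a : A) : Prop :=
  ∀ η : ℝ, 0 < η → ∀ᶠ y in nhds x, ∃ j ∈ fiberIdeal Φ y, ‖a - j‖ < η

theorem smallAt_of_mem {X : Type*} [TopologicalSpace X]
    {A : Type*} [NormedRing A] [StarRing A] [CStarRing A] [NormedAlgebra ℂ A]
    (Φ : C(X, ℂ) →⋆ₐ[ℂ] A) (x : X) (a : A) (ha : a ∈ fiberIdeal Φ x) : SmallAt Φ x a := by
  have h0 : SmallAt Φ x 0 := fun η hη =>
    Filter.Eventually.of_forall fun y => ⟨0, (fiberIdeal Φ y).zero_mem, by simpa using hη⟩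
  have hadd : ∀ {a b : A}, SmallAt Φ x a → SmallAt Φ x b → SmallAt Φ x (a + b) := by
    intro a b ha hb η hη
    filter_upwards [ha (η / 2) (by linarith), hb (η / 2) (by linarith)] with y h1 h2
    obtain ⟨j, hj, h1⟩ := h1
    obtain ⟨k, hk, h2⟩ := h2
    refine ⟨j + k, (fiberIdeal Φ y).add_mem hj hk, ?_⟩
    rw [add_sub_add_comm]
    linarith [norm_add_le (a - j) (b - k)]
  have hneg : ∀ {a : A}, SmallAt Φ x a → SmallAt Φ x (-a) := by
    intro a ha η hη
    filter_upwards [ha η hη] with y h1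
    obtain ⟨j, hj, h1⟩ := h1
    refine ⟨-j, (fiberIdeal Φ y).neg_mem hj, ?_⟩
    rwa [neg_sub_neg, norm_sub_rev]
  have key : ∀ (b : A) (η : ℝ), 0 < η → ∀ t : ℝ, 0 ≤ t → t < η / (‖b‖ + 1) → ‖b‖ * t < η := by
    intro b η hη t ht h
    have hb := norm_nonneg b
    rw [lt_div_iff₀ (by linarith)] at h
    nlinarith
  have hl : ∀ {b a : A}, SmallAt Φ x a → SmallAt Φ x (b * a) := by
    intro b a ha η hη
    filter_upwards [ha (η / (‖b‖ + 1)) (by positivity)] with y h1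
    obtain ⟨j, hj, h1⟩ := h1
    refine ⟨b * j, (fiberIdeal Φ y).mul_mem_left _ _ hj, ?_⟩
    rw [← mul_sub]
    exact (norm_mul_le _ _).trans_lt (key b η hη _ (norm_nonneg _) h1)
  have hr : ∀ {a b : A}, SmallAt Φ x a → SmallAt Φ x (a * b) := by
    intro a b ha η hη
    filter_upwards [ha (η / (‖b‖ + 1)) (by positivity)] with y h1
    obtain ⟨j, hj, h1⟩ := h1
    refine ⟨j * b, (fiberIdeal Φ y).mul_mem_right _ _ hj, ?_⟩
    rw [← sub_mul]
    refine (norm_mul_le _ _).trans_lt ?_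
    rw [mul_comm]
    exact key b η hη _ (norm_nonneg _) h1
  let J : TwoSidedIdeal A := TwoSidedIdeal.mk' {a | SmallAt Φ x a} h0 hadd hneg hl hr
  have hJ : ∀ a, a ∈ J ↔ SmallAt Φ x a := fun a => by
    simp only [J, TwoSidedIdeal.mem_mk', Set.mem_ofPred_eq]
  rw [fiberIdeal, TwoSidedIdeal.mem_sInf] at ha
  refine (hJ a).1 (ha J ⟨?_, ?_⟩)
  · rw [← closure_subset_iff_isClosed]
    intro c hc
    refine (hJ c).2 fun η hη => ?_
    obtain ⟨d, hd, hcd⟩ := Metric.mem_closure_iff.1 hc (η / 2) (by linarith)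
    filter_upwards [(hJ d).1 hd (η / 2) (by linarith)] with y h1
    obtain ⟨j, hj, h1⟩ := h1
    refine ⟨j, hj, ?_⟩
    rw [dist_eq_norm] at hcd
    linarith [norm_sub_le_norm_sub_add_norm_sub c d j]
  · intro f hf
    refine (hJ _).2 fun η hη => ?_
    have hc : Filter.Tendsto (fun y => ‖f y‖ * ‖(1 : A)‖) (nhds x) (nhds 0) := by
      have h : Continuous (fun y => ‖f y‖ * ‖(1 : A)‖) := by fun_prop
      simpa [hf] using h.tendsto x
    filter_upwards [hc.eventually_lt_const hη] with y hy
    refine ⟨Φ (f - algebraMap ℂ C(X, ℂ) (f y)), map_mem_fiberIdeal Φ y _ (by simp), ?_⟩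
    rw [map_sub, sub_sub_cancel, AlgHomClass.commutes, norm_algebraMap]
    exact hy

theorem eventually_norm_lt {X : Type*} [TopologicalSpace X]
    {A : Type*} [NormedRing A] [StarRing A] [CStarRing A] [NormedAlgebra ℂ A]
    (Φ : C(X, ℂ) →⋆ₐ[ℂ] A) (x : X) (a : A) (r : ℝ)
    (h : ‖QuotientAddGroup.mk' (fiberSubgroup Φ x) a‖ < r) :
    ∀ᶠ y in nhds x, ‖QuotientAddGroup.mk' (fiberSubgroup Φ y) a‖ < r := by
  obtain ⟨j, hj, hlt⟩ := (norm_mk_lt_iff _ _ _).1 h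
  filter_upwards [smallAt_of_mem Φ x j ((mem_fiberSubgroup_iff Φ x j).1 hj) (r - ‖a - j‖)
    (by linarith)] with y hy
  obtain ⟨k, hk, hy⟩ := hy
  refine (norm_mk_lt_iff _ _ _).2 ⟨k, (mem_fiberSubgroup_iff Φ y k).2 hk, ?_⟩
  linarith [norm_sub_le_norm_sub_add_norm_sub a j k]

/-- One-tube version of the refinement property. -/
theorem tube_refine {X : Type*} [TopologicalSpace X]
    {A : Type*} [NormedRing A] [StarRing A] [CStarRing A] [NormedAlgebra ℂ A]
    (Φ : C(X, ℂ) →⋆ₐ[ℂ] A) (U : Set X) (hU : IsOpen U) (a : A) (ε : ℝ) (x : X) (c : A)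
    (h : (⟨x, QuotientAddGroup.mk' (fiberSubgroup Φ x) c⟩ :
      Σ x : X, A ⧸ fiberSubgroup Φ x) ∈ tube Φ U a ε) :
    ∃ γ : ℝ, 0 < γ ∧ ∀ᶠ y in nhds x, ∀ s : A ⧸ fiberSubgroup Φ y,
      ‖s - QuotientAddGroup.mk' (fiberSubgroup Φ y) c‖ < γ →
      (⟨y, s⟩ : Σ x : X, A ⧸ fiberSubgroup Φ x) ∈ tube Φ U a ε := by
  obtain ⟨hx, hn⟩ := h
  dsimp only at hx hn
  rw [← map_sub] at hn
  obtain ⟨r, hr1, hr2⟩ := exists_between hn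
  refine ⟨ε - r, by linarith, ?_⟩
  filter_upwards [hU.mem_nhds hx, eventually_norm_lt Φ x (c - a) r hr1] with y hy hy2 s hs
  refine ⟨hy, ?_⟩
  dsimp only
  rw [map_sub] at hy2
  linarith [norm_sub_le_norm_sub_add_norm_sub s (QuotientAddGroup.mk' (fiberSubgroup Φ y) c)
    (QuotientAddGroup.mk' (fiberSubgroup Φ y) a)]

/-- Let `X` be a nonempty compact Hausdorff space, `A` a unital C*-algebra, and
`Φ : C(X, ℂ) → A` a unital star-algebra homomorphism whose range is contained in the
center of `A`.  Form `Â = Σ (x : X), A ⧸ I_x` and the tubes `T(U, a, ε)`.  Then: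
(i) the tubes (with `U` open) cover `Â`; and (ii) for any two tubes `T(U, a, ε)`,
`T(V, b, δ)` (with `U`, `V` open) and any point `p` in their intersection, there exist an
open `W ⊆ X`, `c ∈ A` and `γ > 0` with `p ∈ T(W, c, γ) ⊆ T(U, a, ε) ∩ T(V, b, δ)`.
Hence the family of tubes is a basis for a topology on `Â`. -/
theorem tubes_form_basis {X : Type*} [TopologicalSpace X] [CompactSpace X]
    [T2Space X] [Nonempty X]
    {A : Type*} [NormedRing A] [StarRing A] [CStarRing A] [NormedAlgebra ℂ A]
    [CompleteSpace A] [StarModule ℂ A]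
    (Φ : C(X, ℂ) →⋆ₐ[ℂ] A) (hΦ : ∀ f : C(X, ℂ), Φ f ∈ Set.center A) :
    (∀ p : Σ x : X, A ⧸ fiberSubgroup Φ x,
        ∃ (U : Set X) (a : A) (ε : ℝ), IsOpen U ∧ 0 < ε ∧ p ∈ tube Φ U a ε) ∧
    (∀ (U V : Set X) (a b : A) (ε δ : ℝ)
        (p : Σ x : X, A ⧸ fiberSubgroup Φ x), IsOpen U → IsOpen V →
        p ∈ tube Φ U a ε ∩ tube Φ V b δ →
        ∃ (W : Set X) (c : A) (γ : ℝ), IsOpen W ∧ 0 < γ ∧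
          p ∈ tube Φ W c γ ∧ tube Φ W c γ ⊆ tube Φ U a ε ∩ tube Φ V b δ) := by
  refine ⟨?_, ?_⟩
  · rintro ⟨x, s⟩
    exact ⟨Set.univ, 0, ‖s - QuotientAddGroup.mk' (fiberSubgroup Φ x) 0‖ + 1, isOpen_univ,
      by positivity, Set.mem_univ _, lt_add_one _⟩
  · rintro U V a b ε δ ⟨x, s⟩ hU hV ⟨h1, h2⟩
    obtain ⟨c, rfl⟩ := QuotientAddGroup.mk'_surjective _ s
    obtain ⟨γ₁, hγ₁, e₁⟩ := tube_refine Φ U hU a ε x c h1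
    obtain ⟨γ₂, hγ₂, e₂⟩ := tube_refine Φ V hV b δ x c h2
    obtain ⟨W, hW, hWo, hxW⟩ := eventually_nhds_iff.1 (e₁.and e₂)
    refine ⟨W, c, min γ₁ γ₂, hWo, lt_min hγ₁ hγ₂, ⟨hxW, ?_⟩, ?_⟩
    · simpa using ⟨hγ₁, hγ₂⟩
    · rintro ⟨y, t⟩ ⟨hy, ht⟩
      exact ⟨(hW y hy).1 t (ht.trans_le (min_le_left _ _)),
        (hW y hy).2 t (ht.trans_le (min_le_right _ _))⟩
end
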